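/- Let Y be a random element of ℝ₀^{ℤ^d} satisfying the tail-process identity with P(Y ∈ E₀) = 1, A an anchoring function, ϑ_A := P(A(Y) = 0) > 0, and Z^A the anchored process with law P(Y ∈ · | A(Y) = 0). Then for every measurable h : E₀ → [0,∞): E[h(Z^A)] = ϑ_A^{−1} E[h(θ_{A(Y)} Y) / |e(Y)|], where |e(Y)| is the (almost surely finite) number of exceedance-points of Y. -/

import Mathlib

open MeasureTheory ENNReal Filter ProbabilityTheory

noncomputable section

/-- The space `ℝ^{ℤ^d}` of real-valued fields indexed by `ℤ^d`. -/
abbrev RField (d : ℕ) := (Fin d → ℤ) → ℝ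

variable {d : ℕ}

/-- Shift operator: `shift k x = (x_{i+k})_i`, i.e. it moves the origin to `k`. -/
def shift (k : Fin d → ℤ) (x : RField d) : RField d := fun i => x (i + k)

/-- The set of exceedance-points of `x`. -/
def excSet (x : RField d) : Set (Fin d → ℤ) := {k | 1 < |x k|}

open Classical in
/-- Indicator (with values in `ℝ≥0∞`) of the event that `|x k| > s`. -/
def exIndGT (s : ℝ) (k : Fin d → ℤ) (x : RField d) : ℝ≥0∞ := if s < |x k| then 1 else 0

/-- The tail-process identity:
`E[h(θ_k Y) 1{|Y_k| > 1}] = E[h(Y) 1{|Y_{−k}| > 1}]` for every measurable nonnegative `h`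
and every `k ∈ ℤ^d`. -/
def TailIdentity {Ω : Type*} [MeasurableSpace Ω] (μ : Measure Ω) (Y : Ω → RField d) : Prop :=
  ∀ h : RField d → ℝ≥0∞, Measurable h → ∀ k : Fin d → ℤ,
    ∫⁻ ω, h (shift k (Y ω)) * exIndGT 1 k (Y ω) ∂μ
      = ∫⁻ ω, h (Y ω) * exIndGT 1 (-k) (Y ω) ∂μ

/-- `Y` is exceedance-stationary: for every exceedance-map `τ` which is bijective on a
measurable set `B` (invariant under shifting the origin to exceedance-points, contained in
`ℝ₀^{ℤ^d}`) carrying the law of `Y`, we have `θ_τ Y ≐ Y`. -/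
def ExcStationary {Ω : Type*} [MeasurableSpace Ω] (μ : Measure Ω) (Y : Ω → RField d) : Prop :=
  ∀ (B : Set (RField d)) (τ : RField d → Fin d → ℤ),
    MeasurableSet B → Measurable τ →
    (∀ x ∈ B, 1 < |x 0|) →
    (∀ x ∈ B, ∀ k ∈ excSet x, shift k x ∈ B) →
    (∀ x ∈ B, τ x ∈ excSet x) →
    (∀ x ∈ B, Set.BijOn (fun k => k + τ (shift k x)) (excSet x) (excSet x)) →
    (∀ᵐ ω ∂μ, Y ω ∈ B) →
    Measure.map (fun ω => shift (τ (Y ω)) (Y ω)) μ = Measure.map Y μ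

/-- `E₀`: elements of `ℝ₀^{ℤ^d}` with finitely many exceedance-points. -/
def E0set (d : ℕ) : Set (RField d) := {x | 1 < |x 0| ∧ (excSet x).Finite}

/-- `E`: elements of `ℝ^{ℤ^d}` with at least one but finitely many exceedance-points. -/
def Eset (d : ℕ) : Set (RField d) := {x | (excSet x).Nonempty ∧ (excSet x).Finite}

/-- `l₀`: fields vanishing at infinity. -/
def l0set (d : ℕ) : Set (RField d) := {x | Tendsto (fun i => |x i|) cofinite (nhds 0)}

/-- Uniform norm `‖x‖ = sup_i |x_i|`. -/
def supNorm (x : RField d) : ℝ := ⨆ i, |x i|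

/-- `V` is Pareto(α)-distributed: `P(V > y) = y^{-α}` for `y ≥ 1`. -/
def IsPareto {Ω : Type*} [MeasurableSpace Ω] (μ : Measure Ω) (V : Ω → ℝ) (α : ℝ) : Prop :=
  ∀ y : ℝ, 1 ≤ y → μ {ω | y < V ω} = ENNReal.ofReal (y ^ (-α))

/-- An anchoring function on `S`: a measurable shift-covariant exceedance-map. -/
def IsAnchoringOn (S : Set (RField d)) (A : RField d → Fin d → ℤ) : Prop :=
  Measurable A ∧ ∀ x ∈ S, A x ∈ excSet x ∧ ∀ k ∈ excSet x, A (shift k x) + k = A x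

/-- `h` is shift-invariant on `S`. -/
def ShiftInvariantOn (S : Set (RField d)) (h : RField d → ℝ≥0∞) : Prop :=
  ∀ x ∈ S, ∀ k : Fin d → ℤ, h (shift k x) = h x

theorem tsum_exIndGT_one (x : RField d) : ∑' k, exIndGT 1 k x = (excSet x).encard := by
  rw [← ENNReal.tsum_set_one, tsum_subtype (excSet x) (fun _ => (1 : ℝ≥0∞))]
  refine tsum_congr fun k => ?_
  simp [exIndGT, excSet, Set.indicator_apply]

theorem measurable_exIndGT (s : ℝ) (k : Fin d → ℤ) :
    Measurable (exIndGT s k : RField d → ℝ≥0∞) := by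
  unfold exIndGT
  exact Measurable.ite (measurableSet_lt measurable_const (measurable_pi_apply k).abs)
    measurable_const measurable_const

theorem measurable_shift (k : Fin d → ℤ) : Measurable (shift k : RField d → RField d) :=
  measurable_pi_lambda _ fun i => measurable_pi_apply (i + k)

theorem measurable_encard_excSet :
    Measurable fun x : RField d => ((excSet x).encard : ℝ≥0∞) := by
  simp_rw [← tsum_exIndGT_one]
  exact Measurable.tsum fun k => measurable_exIndGT 1 k

theorem encard_excSet_shift (k : Fin d → ℤ) (x : RField d) :
    (excSet (shift k x)).encard = (excSet x).encard :=
  Set.encard_preimage_of_bijective (Equiv.addRight k).bijective (excSet x)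

/-- Mass transport: summing the tail-process identity over all shifts. -/
theorem TailIdentity.lintegral_tsum_shift {Ω : Type*} [MeasurableSpace Ω] {μ : Measure Ω}
    {Y : Ω → RField d} (hTI : TailIdentity μ Y) (hY : Measurable Y)
    {g : RField d → ℝ≥0∞} (hg : Measurable g) :
    ∫⁻ ω, ∑' k, g (shift k (Y ω)) * exIndGT 1 k (Y ω) ∂μ
      = ∫⁻ ω, g (Y ω) * (excSet (Y ω)).encard ∂μ := by
  have hex : ∀ k, Measurable fun ω => exIndGT 1 k (Y ω) :=
    fun k => (measurable_exIndGT 1 k).comp hY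
  have hl : ∀ k, AEMeasurable (fun ω => g (shift k (Y ω)) * exIndGT 1 k (Y ω)) μ :=
    fun k => ((hg.comp ((measurable_shift k).comp hY)).mul (hex k)).aemeasurable
  have hr : ∀ k, AEMeasurable (fun ω => g (Y ω) * exIndGT 1 (-k) (Y ω)) μ :=
    fun k => ((hg.comp hY).mul (hex (-k))).aemeasurable
  rw [lintegral_tsum hl]
  simp_rw [hTI g hg]
  rw [← lintegral_tsum hr]
  refine lintegral_congr fun ω => ?_
  rw [ENNReal.tsum_mul_left, ← tsum_exIndGT_one]
  congr 1
  exact (Equiv.neg (Fin d → ℤ)).tsum_eq fun k => exIndGT 1 k (Y ω)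

/-- Among the exceedance-points of `x ∈ E₀`, exactly the anchor becomes the anchored origin. -/
theorem IsAnchoringOn.tsum_indicator_shift {A : RField d → Fin d → ℤ}
    (hA : IsAnchoringOn (E0set d) A) (f : RField d → ℝ≥0∞) {x : RField d} (hx : x ∈ E0set d) :
    ∑' k, {y | A y = 0}.indicator f (shift k x) * exIndGT 1 k x = f (shift (A x) x) := by
  obtain ⟨hmem, hcov⟩ := hA.2 x hx
  rw [tsum_eq_single (A x)]
  · have h0 : A (shift (A x) x) = 0 := by simpa using hcov _ hmem
    have h1 : 1 < |x (A x)| := hmem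
    simp [h0, exIndGT, h1]
  · intro k hk
    by_cases hke : k ∈ excSet x
    · have h0 : A (shift k x) ≠ 0 := fun h0 => hk (by simpa [h0] using hcov k hke)
      simp [h0]
    · have h1 : ¬ 1 < |x k| := hke
      simp [exIndGT, h1]

/-- With `Y`, `A`, `ϑ_A` and the anchored process `Z^A` as in the Palm
duality, for every measurable `h ≥ 0`:
`E[h(Z^A)] = ϑ_A⁻¹ E[h(θ_{A(Y)} Y) / |e(Y)|]`. -/
theorem palm_inversion_dual
    {Ω : Type*} [MeasurableSpace Ω] (μ : Measure Ω) [IsProbabilityMeasure μ]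
    (Y : Ω → RField d) (hY : Measurable Y) (hTI : TailIdentity μ Y)
    (hE0 : ∀ᵐ ω ∂μ, Y ω ∈ E0set d)
    (A : RField d → Fin d → ℤ) (hA : IsAnchoringOn (E0set d) A)
    (hpos : 0 < μ {ω | A (Y ω) = 0}) :
    ∀ h : RField d → ℝ≥0∞, Measurable h →
      ∫⁻ x, h x ∂(ProbabilityTheory.cond (Measure.map Y μ) {x | A x = 0})
        = (μ {ω | A (Y ω) = 0})⁻¹ *
            ∫⁻ ω, h (shift (A (Y ω)) (Y ω)) / (excSet (Y ω)).encard ∂μ := by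
  intro h hh
  have hS : MeasurableSet {x : RField d | A x = 0} := hA.1 (measurableSet_singleton 0)
  set f : RField d → ℝ≥0∞ := fun x => h x / (excSet x).encard with hf
  have hfm : Measurable f := hh.div measurable_encard_excSet
  rw [ProbabilityTheory.cond, lintegral_smul_measure, Measure.map_apply hY hS, smul_eq_mul,
    ← lintegral_indicator hS, lintegral_map (hh.indicator hS) hY]
  congr 1
  calc ∫⁻ ω, {x | A x = 0}.indicator h (Y ω) ∂μ
      = ∫⁻ ω, {x | A x = 0}.indicator f (Y ω) * (excSet (Y ω)).encard ∂μ := by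
        refine lintegral_congr_ae ?_
        filter_upwards [hE0] with ω hω
        have hne : ((excSet (Y ω)).encard : ℝ≥0∞) ≠ 0 := by
          simpa using Set.Nonempty.ne_empty ⟨0, hω.1⟩
        have htop : ((excSet (Y ω)).encard : ℝ≥0∞) ≠ ∞ := by
          simpa using hω.2
        by_cases h0 : A (Y ω) = 0
        · simp [h0, hf, ENNReal.div_mul_cancel hne htop]
        · simp [h0]
    _ = ∫⁻ ω, ∑' k, {x | A x = 0}.indicator f (shift k (Y ω)) * exIndGT 1 k (Y ω) ∂μ :=
        (hTI.lintegral_tsum_shift hY (hfm.indicator hS)).symm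
    _ = ∫⁻ ω, h (shift (A (Y ω)) (Y ω)) / (excSet (Y ω)).encard ∂μ := by
        refine lintegral_congr_ae ?_
        filter_upwards [hE0] with ω hω
        rw [hA.tsum_indicator_shift f hω, hf]
        simp only [encard_excSet_shift]
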